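/- Let k be a field of characteristic 0 and let G = SL_2(k) act on the polynomial ring k[A_0,...,A_d] by coordinate change on binary forms of degree d. If R_d denotes the subring of G-invariant polynomials, then every maximal ideal of R_d is contained in a maximal ideal of k[A_0,...,A_d]; equivalently, no proper ideal of R_d generates the unit ideal of k[A_0,...,A_d]. -/

import Mathlib

open MvPolynomial
noncomputable section

/-- The binary form of degree `d` with coefficient vector `a`. -/
def toForm (k : Type*) [CommSemiring k] (d : ℕ) (a : Fin (d+1) → k) :
    MvPolynomial (Fin 2) k :=
  ∑ i : Fin (d+1), C (a i) * X 0 ^ (d - (i : ℕ)) * X 1 ^ (i : ℕ)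

/-- Coordinate change by the matrix `g` : `X ↦ g00 X + g01 Y`, `Y ↦ g10 X + g11 Y`. -/
def matAct (k : Type*) [CommSemiring k] (g : Matrix (Fin 2) (Fin 2) k)
    (p : MvPolynomial (Fin 2) k) : MvPolynomial (Fin 2) k :=
  aeval (fun j : Fin 2 => C (g j 0) * X 0 + C (g j 1) * X 1) p

/-- The coefficient of `X^(d-i) Y^i` in a binary form of degree `d`. -/
def formCoeff (k : Type*) [CommSemiring k] (d : ℕ) (p : MvPolynomial (Fin 2) k)
    (i : Fin (d+1)) : k :=
  coeff (Finsupp.single 0 (d - (i : ℕ)) + Finsupp.single 1 (i : ℕ)) p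

/-- The induced action of a `2×2` matrix on the coefficient vector of a binary form. -/
def actCoeff (k : Type*) [CommSemiring k] (d : ℕ) (g : Matrix (Fin 2) (Fin 2) k)
    (a : Fin (d+1) → k) : Fin (d+1) → k :=
  formCoeff k d (matAct k g (toForm k d a))

/-- `P ∈ k[A_0,…,A_d]` is an `SL₂(k)`-invariant. -/
def SL2Invariant (k : Type*) [CommRing k] (d : ℕ)
    (P : MvPolynomial (Fin (d+1)) k) : Prop :=
  ∀ g : Matrix.SpecialLinearGroup (Fin 2) k, ∀ a : Fin (d+1) → k,
    eval (actCoeff k d (g : Matrix (Fin 2) (Fin 2) k) a) P = eval a P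

/-- The ring `R_d` of `SL₂(k)`-invariants in `k[A_0,…,A_d]`. -/
def Rd (k : Type*) [Field k] (d : ℕ) : Subalgebra k (MvPolynomial (Fin (d+1)) k) where
  carrier := {P | SL2Invariant k d P}
  mul_mem' := fun hP hQ g a => by simp only [map_mul]; rw [hP g a, hQ g a]
  add_mem' := fun hP hQ g a => by simp only [map_add]; rw [hP g a, hQ g a]
  algebraMap_mem' := fun r g a => by simp [SL2Invariant]

section abstractSl2
variable {k V : Type*} [Field k] [CharZero k] [AddCommGroup V] [Module k V]
  (E F H : V →ₗ[k] V)

lemma sl2_H_F (hHF : ∀ v, H (F v) = F (H v) - (2:k) • F v) (v : V) (μ : k) (hv : H v = μ • v) (n : ℕ) :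
    H (F^[n] v) = (μ - 2 * n) • F^[n] v := by
  induction n with
  | zero => simp [hv]
  | succ n ih =>
    rw [Function.iterate_succ_apply', hHF, ih, map_smul, ← sub_smul]
    congr 1; push_cast; ring

lemma sl2_H_E (hHE : ∀ v, H (E v) = E (H v) + (2:k) • E v) (v : V) (μ : k) (hv : H v = μ • v) (n : ℕ) :
    H (E^[n] v) = (μ + 2 * n) • E^[n] v := by
  induction n with
  | zero => simp [hv]
  | succ n ih =>
    rw [Function.iterate_succ_apply', hHE, ih, map_smul, ← add_smul]
    congr 1; push_cast; ring

lemma sl2_E_F (hEF : ∀ v, E (F v) = F (E v) + H v)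
    (hHF : ∀ v, H (F v) = F (H v) - (2:k) • F v) (v : V) (μ : k) (hv : H v = μ • v) (n : ℕ) :
    E (F^[n+1] v) = F^[n+1] (E v) + ((n+1) * (μ - n) : k) • F^[n] v := by
  induction n with
  | zero => simp [hEF, hv]
  | succ n ih =>
    rw [Function.iterate_succ_apply', hEF, ih, sl2_H_F F H hHF v μ hv, map_add, map_smul,
      ← Function.iterate_succ_apply' F, ← Function.iterate_succ_apply' F, add_assoc, ← add_smul]
    congr 2; push_cast; ring

lemma sl2_F_zero (hEF : ∀ v, E (F v) = F (E v) + H v)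
    (hHF : ∀ v, H (F v) = F (H v) - (2:k) • F v) (v : V) (hv : H v = 0) (hE : E v = 0)
    (hn : ∃ n, F^[n] v = 0) : F v = 0 := by
  obtain ⟨n, hn⟩ := hn
  have key : ∀ n, F^[n+1] v = 0 → F v = 0 := by
    intro n
    induction n with
    | zero => intro h; simpa using h
    | succ n ih =>
      intro h
      apply ih
      have := sl2_E_F E F H hEF hHF v 0 (by simp [hv]) (n+1)
      rw [h, hE, iterate_map_zero, map_zero, zero_add] at this
      refine (smul_eq_zero.1 this.symm).resolve_left ?_
      have h1 : ((n:k)+1) ≠ 0 := by exact_mod_cast Nat.succ_ne_zero n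
      have h2 : ((n:k)+1+1) ≠ 0 := by exact_mod_cast Nat.succ_ne_zero (n+1)
      push_cast
      exact mul_ne_zero h2 (by rw [zero_sub]; exact neg_ne_zero.2 h1)
  exact key n (by rw [Function.iterate_succ_apply', hn, map_zero])

/-- coefficients of the extremal projector -/
def sl2c (k : Type*) [Field k] (n : ℕ) : k := (-1)^n / (n.factorial * (n+1).factorial)

lemma sl2c_succ (n : ℕ) : sl2c k (n+1) * ((n+1) * (n+2)) = - sl2c k n := by
  unfold sl2c
  have h1 : ((n:k)+1) ≠ 0 := by exact_mod_cast Nat.succ_ne_zero n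
  have h2 : ((n:k)+1+1) ≠ 0 := by exact_mod_cast Nat.succ_ne_zero (n+1)
  have h3 : (n.factorial : k) ≠ 0 := by exact_mod_cast Nat.factorial_ne_zero n
  simp only [Nat.factorial_succ]
  push_cast
  field_simp
  ring

/-- truncated extremal projector -/
def sl2P (N : ℕ) (v : V) : V := ∑ n ∈ Finset.range N, sl2c k n • F^[n] (E^[n] v)

lemma sl2_E_P (hEF : ∀ v, E (F v) = F (E v) + H v)
    (hHF : ∀ v, H (F v) = F (H v) - (2:k) • F v)
    (hHE : ∀ v, H (E v) = E (H v) + (2:k) • E v)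
    (v : V) (hv : H v = 0) (N : ℕ) :
    E (sl2P E F (N+1) v) = sl2c k N • F^[N] (E^[N+1] v) := by
  induction N with
  | zero => simp [sl2P]
  | succ N ih =>
    unfold sl2P at ih ⊢
    rw [Finset.sum_range_succ, map_add, ih, map_smul,
      sl2_E_F E F H hEF hHF (E^[N+1] v) _ (sl2_H_E E H hHE v 0 (by simp [hv]) (N+1)) N,
      ← Function.iterate_succ_apply' E, smul_add, smul_smul, add_left_comm, ← add_smul]
    have : sl2c k N + sl2c k (N+1) * (((N:k)+1) * (0 + 2 * ((N+1 : ℕ):k) - N)) = 0 := by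
      have := sl2c_succ (k := k) N
      push_cast
      linear_combination this
    rw [this, zero_smul, add_zero]

lemma sl2_H_P 
    (hHF : ∀ v, H (F v) = F (H v) - (2:k) • F v)
    (hHE : ∀ v, H (E v) = E (H v) + (2:k) • E v)
    (v : V) (hv : H v = 0) (N : ℕ) :
    H (sl2P E F N v) = 0 := by
  unfold sl2P
  rw [map_sum]
  apply Finset.sum_eq_zero
  intro n _
  rw [map_smul, sl2_H_F F H hHF _ _ (sl2_H_E E H hHE v 0 (by simp [hv]) n)]
  simp
end abstractSl2

section deriv
variable (k : Type*) [Field k] (d : ℕ)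

def dE : Derivation k (MvPolynomial (Fin (d+1)) k) (MvPolynomial (Fin (d+1)) k) :=
  mkDerivation k (fun i => if h : 0 < (i:ℕ) then C ((d:k) - i + 1) * X ⟨i - 1, by omega⟩ else 0)

def dF : Derivation k (MvPolynomial (Fin (d+1)) k) (MvPolynomial (Fin (d+1)) k) :=
  mkDerivation k (fun i => if h : (i:ℕ) < d then C ((i:k) + 1) * X ⟨i + 1, by omega⟩ else 0)

def dH : Derivation k (MvPolynomial (Fin (d+1)) k) (MvPolynomial (Fin (d+1)) k) :=
  mkDerivation k (fun i => C ((d:k) - 2 * i) * X i)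

variable {k d}

lemma der_C_mul (D : Derivation k (MvPolynomial (Fin (d+1)) k) (MvPolynomial (Fin (d+1)) k)) (r : k) (p) :
    D (C r * p) = C r * D p := by
  rw [← MvPolynomial.smul_eq_C_mul, Derivation.map_smul, MvPolynomial.smul_eq_C_mul]

lemma dEF : ⁅dE k d, dF k d⁆ = dH k d := by
  apply derivation_ext
  intro i
  rw [Derivation.commutator_apply]
  obtain ⟨i, hi⟩ := i
  simp only [dE, dF, dH, mkDerivation_X]
  rcases Nat.eq_zero_or_pos i with h0 | h0 <;> rcases Nat.lt_or_ge i d with h1 | h1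
  · subst h0; simp [h1, der_C_mul, mkDerivation_X]
  · obtain rfl : d = 0 := by omega
    subst h0; simp
  · simp only [h0, h1, dif_pos, der_C_mul, mkDerivation_X]
    rw [dif_pos (by simp), dif_pos (by first | omega | (simp; omega))]
    simp only [Nat.add_sub_cancel, Nat.sub_add_cancel h0, ← mul_assoc, ← sub_mul, ← C_mul, ← C_sub]
    congr 2
    push_cast [Nat.cast_sub (show 1 ≤ i from h0)]
    ring
  · obtain rfl : i = d := by omega
    simp only [h0, dif_pos, der_C_mul, mkDerivation_X]
    rw [dif_neg (by simp), dif_pos (by first | omega | (simp; omega))]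
    simp only [Nat.sub_add_cancel h0, ← mul_assoc, map_zero, zero_sub, ← C_mul, ← neg_mul, ← C_neg]
    congr 2
    push_cast [Nat.cast_sub (show 1 ≤ i from h0)]
    ring

lemma dHF : ⁅dH k d, dF k d⁆ = - (2:k) • dF k d := by
  apply derivation_ext
  intro i
  rw [Derivation.commutator_apply]
  obtain ⟨i, hi⟩ := i
  simp only [dF, dH, mkDerivation_X, Derivation.smul_apply]
  by_cases h1 : i < d
  · simp only [h1, dif_pos, der_C_mul, mkDerivation_X, MvPolynomial.smul_eq_C_mul]
    simp only [← mul_assoc, ← sub_mul, ← C_mul, ← C_sub]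
    congr 2
    push_cast
    ring
  · simp [h1, der_C_mul, mkDerivation_X]

lemma dHE : ⁅dH k d, dE k d⁆ = (2:k) • dE k d := by
  apply derivation_ext
  intro i
  rw [Derivation.commutator_apply]
  obtain ⟨i, hi⟩ := i
  simp only [dE, dH, mkDerivation_X, Derivation.smul_apply]
  by_cases h1 : 0 < i
  · simp only [h1, dif_pos, der_C_mul, mkDerivation_X, MvPolynomial.smul_eq_C_mul]
    simp only [← mul_assoc, ← sub_mul, ← C_mul, ← C_sub]
    congr 2
    push_cast [Nat.cast_sub (show 1 ≤ i from h1)]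
    ring
  · rw [dif_neg h1, der_C_mul, mkDerivation_X, dif_neg h1]; simp

lemma hEF (v : MvPolynomial (Fin (d+1)) k) : dE k d (dF k d v) = dF k d (dE k d v) + dH k d v := by
  rw [← dEF, Derivation.commutator_apply]; ring
lemma hHF (v : MvPolynomial (Fin (d+1)) k) : dH k d (dF k d v) = dF k d (dH k d v) - (2:k) • dF k d v := by
  have := congrArg (fun D => D v) (dHF (k := k) (d := d))
  simp only [Derivation.commutator_apply, Derivation.smul_apply, neg_smul] at this
  linear_combination this
lemma hHE (v : MvPolynomial (Fin (d+1)) k) : dH k d (dE k d v) = dE k d (dH k d v) + (2:k) • dE k d v := by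
  have := congrArg (fun D => D v) (dHE (k := k) (d := d))
  simp only [Derivation.commutator_apply, Derivation.smul_apply] at this
  linear_combination this

/-- local nilpotency -/
lemma nil_mul (D : Derivation k (MvPolynomial (Fin (d+1)) k) (MvPolynomial (Fin (d+1)) k)) :
    ∀ N n m : ℕ, n + m = N → ∀ x y, D^[n] x = 0 → D^[m] y = 0 → D^[N] (x * y) = 0 := by
  have hz : ∀ n, D^[n] 0 = 0 := fun n => iterate_map_zero D n
  intro N
  induction N with
  | zero =>
    intro n m h x y hx hy
    obtain rfl : n = 0 := by omega
    simp at hx; simp [hx]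
  | succ N ih =>
    intro n m h x y hx hy
    rcases n with _ | n
    · simp only [Function.iterate_zero, id] at hx
      rw [hx, zero_mul, hz]
    rcases m with _ | m
    · simp only [Function.iterate_zero, id] at hy
      rw [hy, mul_zero, hz]
    rw [Function.iterate_succ_apply, D.leibniz, iterate_map_add, smul_eq_mul, smul_eq_mul,
      ih (n+1) m (by omega) x (D y) hx (by rwa [Function.iterate_succ_apply] at hy), mul_comm,
      ih n (m+1) (by omega) (D x) y (by rwa [Function.iterate_succ_apply] at hx) hy, add_zero]

lemma nil_mono (D : Derivation k (MvPolynomial (Fin (d+1)) k) (MvPolynomial (Fin (d+1)) k))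
    {n m : ℕ} (h : n ≤ m) {x} (hx : D^[n] x = 0) : D^[m] x = 0 := by
  obtain ⟨c, rfl⟩ := Nat.exists_eq_add_of_le' h
  rw [Function.iterate_add_apply, hx, iterate_map_zero]

lemma nil_all (D : Derivation k (MvPolynomial (Fin (d+1)) k) (MvPolynomial (Fin (d+1)) k))
    (hX : ∀ i, ∃ n, D^[n] (X i) = 0) (f) : ∃ n, D^[n] f = 0 := by
  induction f using MvPolynomial.induction_on with
  | C a => exact ⟨1, by simp [MvPolynomial.derivation_C]⟩
  | add p q hp hq =>
    obtain ⟨n, hn⟩ := hp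
    obtain ⟨m, hm⟩ := hq
    exact ⟨n + m, by rw [iterate_map_add, nil_mono D (by omega) hn, nil_mono D (by omega) hm, add_zero]⟩
  | mul_X p i hp =>
    obtain ⟨n, hn⟩ := hp
    obtain ⟨m, hm⟩ := hX i
    exact ⟨n + m, nil_mul D _ n m rfl _ _ hn hm⟩

lemma iter_C_mul (D : Derivation k (MvPolynomial (Fin (d+1)) k) (MvPolynomial (Fin (d+1)) k)) (n : ℕ) (r : k) (p) :
    D^[n] (C r * p) = C r * D^[n] p := by
  induction n with
  | zero => rfl
  | succ n ih => rw [Function.iterate_succ_apply', ih, der_C_mul, Function.iterate_succ_apply']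

lemma nil_E (f) : ∃ n, (dE k d)^[n] f = 0 := by
  apply nil_all
  rintro ⟨i, hi⟩
  refine ⟨i + 1, ?_⟩
  induction i with
  | zero => simp [dE, mkDerivation_X]
  | succ i ih =>
    rw [Function.iterate_succ_apply]
    nth_rewrite 2 [dE]
    rw [mkDerivation_X, dif_pos (by simp), iter_C_mul]
    simp only [Nat.add_sub_cancel]
    rw [ih (by omega), mul_zero]

lemma nil_F (f) : ∃ n, (dF k d)^[n] f = 0 := by
  apply nil_all
  have : ∀ j i : ℕ, ∀ hi : i < d + 1, i + j = d → (dF k d)^[j+1] (X ⟨i, hi⟩) = 0 := by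
    intro j
    induction j with
    | zero => intro i hi h; obtain rfl : i = d := by omega
              simp [dF, mkDerivation_X]
    | succ j ih =>
      intro i hi h
      rw [Function.iterate_succ_apply]
      nth_rewrite 2 [dF]
      rw [mkDerivation_X, dif_pos (by first | omega | (simp; omega)), iter_C_mul]
      rw [ih _ _ (by first | omega | (simp; omega)), mul_zero]
  rintro ⟨i, hi⟩
  exact ⟨_, this (d - i) i hi (by omega)⟩

/-- weights -/
def wt (d : ℕ) : Fin (d+1) → ℤ := fun i => (d:ℤ) - 2 * (i:ℤ)

lemma dH_monomial (m : Fin (d+1) →₀ ℕ) (r : k) :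
    dH k d (monomial m r) = ((Finsupp.weight (wt d) m : ℤ) : k) • monomial m r := by
  suffices h : dH k d (monomial m 1) = ((Finsupp.weight (wt d) m : ℤ) : k) • monomial m 1 by
    have e : monomial m r = r • monomial m (1:k) := by simp [smul_monomial]
    rw [e, Derivation.map_smul, h, smul_comm]
  induction m using Finsupp.induction_linear with
  | zero => simp
  | add a b ha hb =>
    have e : monomial (a + b) (1:k) = monomial a 1 * monomial b 1 := by simp [monomial_mul]
    rw [e, Derivation.leibniz, ha, hb, map_add]
    push_cast
    simp only [smul_eq_mul, mul_smul_comm, add_smul]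
    rw [mul_comm (monomial b (1:k))]
    exact add_comm _ _
  | single i n =>
    rw [← X_pow_eq_monomial, Derivation.leibniz_pow, dH, mkDerivation_X]
    rcases n with _ | n
    · simp
    simp only [Finsupp.weight_single, wt, MvPolynomial.smul_eq_C_mul, smul_eq_mul, Nat.add_sub_cancel]
    have e : ((((n + 1) • ((d:ℤ) - 2 * ((i:ℕ):ℤ)) : ℤ)) : k) = ((n:k)+1) * ((d:k) - 2 * (i:ℕ)) := by
      push_cast; simp
    rw [e, nsmul_eq_mul]
    push_cast
    simp only [map_mul, map_natCast, map_add, map_one]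
    ring

lemma coeff_dH (f : MvPolynomial (Fin (d+1)) k) (m) :
    coeff m (dH k d f) = ((Finsupp.weight (wt d) m : ℤ) : k) * coeff m f := by
  classical
  induction f using MvPolynomial.induction_on' with
  | monomial u a =>
    rw [dH_monomial, coeff_smul, coeff_monomial]
    split_ifs with h
    · rw [h, smul_eq_mul]
    · simp
  | add p q hp hq => rw [map_add, coeff_add, coeff_add, hp, hq, mul_add]

lemma dH_zero_iff [CharZero k] (f : MvPolynomial (Fin (d+1)) k) :
    dH k d f = 0 ↔ IsWeightedHomogeneous (wt d) f 0 := by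
  constructor
  · intro h m hm
    have := coeff_dH f m
    rw [h, coeff_zero] at this
    exact_mod_cast (mul_eq_zero.1 this.symm).resolve_right hm
  · intro h
    ext m
    rw [coeff_dH, coeff_zero]
    by_cases hm : coeff m f = 0
    · simp [hm]
    · rw [h hm]; simp

def pi0 (d : ℕ) : MvPolynomial (Fin (d+1)) k →ₗ[k] MvPolynomial (Fin (d+1)) k :=
  weightedHomogeneousComponent (wt d) 0

lemma pi0_mul (x f : MvPolynomial (Fin (d+1)) k) (hx : IsWeightedHomogeneous (wt d) x 0) :
    pi0 d (f * x) = pi0 d f * x := by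
  classical
  let _ := weightedGradedAlgebra k (wt d)
  have := DirectSum.coe_decompose_mul_of_right_mem_zero (weightedHomogeneousSubmodule k (wt d)) (i := 0) (a := f) (b := x) hx
  have e : ∀ g, ((DirectSum.decompose (weightedHomogeneousSubmodule k (wt d)) g 0 : _) :
      MvPolynomial (Fin (d+1)) k) = pi0 d g :=
    fun g => weightedDecomposition.decompose'_apply k (wt d) g 0
  rw [e, e] at this
  exact this

end deriv
section group
variable {k : Type*} [Field k] {d : ℕ}

lemma mon_eq (p q : ℕ) (c : k) :
    C c * X 0 ^ p * X 1 ^ q = monomial (Finsupp.single (0 : Fin 2) p + Finsupp.single 1 q) c := by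
  rw [X_pow_eq_monomial, X_pow_eq_monomial, C_mul_monomial, monomial_mul]; simp

lemma exp_inj (p q p' q' : ℕ) :
    (Finsupp.single (0 : Fin 2) p + Finsupp.single 1 q = Finsupp.single 0 p' + Finsupp.single 1 q')
      ↔ (p = p' ∧ q = q') := by
  constructor
  · intro h
    have h0 := DFunLike.congr_fun h 0
    have h1 := DFunLike.congr_fun h 1
    simp at h0 h1
    exact ⟨h0, h1⟩
  · rintro ⟨rfl, rfl⟩; rfl

lemma coeff_upper (t : k) (i j : ℕ) (hi : i ≤ d) (hj : j ≤ d) :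
    coeff (Finsupp.single (0 : Fin 2) (d - j) + Finsupp.single 1 j)
      ((X 0 + C t * X 1) ^ (d - i) * X 1 ^ i : MvPolynomial (Fin 2) k)
      = (Nat.choose (d - i) (d - j) : k) * t ^ (j - i) := by
  classical
  rw [add_pow, Finset.sum_mul, coeff_sum]
  have e : ∀ m ∈ Finset.range (d - i + 1), coeff (Finsupp.single (0 : Fin 2) (d - j) + Finsupp.single 1 j)
      ((X 0 ^ m * (C t * X 1) ^ (d - i - m) * (Nat.choose (d-i) m : MvPolynomial (Fin 2) k) * X 1 ^ i : MvPolynomial (Fin 2) k))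
      = if m = d - j then (Nat.choose (d - i) (d - j) : k) * t ^ (j - i) else 0 := by
    intro m hm
    have hm : m ≤ d - i := by simpa [Nat.lt_succ_iff] using hm
    have : (X 0 ^ m * (C t * X 1) ^ (d - i - m) * (Nat.choose (d-i) m : MvPolynomial (Fin 2) k) * X 1 ^ i : MvPolynomial (Fin 2) k)
      = C ((Nat.choose (d-i) m : k) * t ^ (d - i - m)) * X 0 ^ m * X 1 ^ (d - i - m + i) := by
      rw [mul_pow, C_mul, C_pow, pow_add, map_natCast]; ring
    rw [this, mon_eq, coeff_monomial]
    simp only [exp_inj]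
    by_cases h : m = d - j
    · rw [if_pos ⟨h, by omega⟩, if_pos h, h]
      congr 2; omega
    · rw [if_neg (fun h' => h h'.1), if_neg h]
  rw [Finset.sum_congr rfl e, Finset.sum_ite_eq']
  split_ifs with h
  · rfl
  · rw [Nat.choose_eq_zero_of_lt (by rw [Finset.mem_range] at h; omega)]; simp

lemma coeff_lower (t : k) (i j : ℕ) (hi : i ≤ d) (hj : j ≤ d) :
    coeff (Finsupp.single (0 : Fin 2) (d - j) + Finsupp.single 1 j)
      (X 0 ^ (d - i) * (X 1 + C t * X 0) ^ i : MvPolynomial (Fin 2) k)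
      = (Nat.choose i j : k) * t ^ (i - j) := by
  classical
  rw [add_pow, Finset.mul_sum, coeff_sum]
  have e : ∀ m ∈ Finset.range (i + 1), coeff (Finsupp.single (0 : Fin 2) (d - j) + Finsupp.single 1 j)
      (X 0 ^ (d - i) * (X 1 ^ m * (C t * X 0) ^ (i - m) * (Nat.choose i m : MvPolynomial (Fin 2) k)) : MvPolynomial (Fin 2) k)
      = if m = j then (Nat.choose i j : k) * t ^ (i - j) else 0 := by
    intro m hm
    have hm : m ≤ i := by simpa [Nat.lt_succ_iff] using hm
    have : (X 0 ^ (d - i) * (X 1 ^ m * (C t * X 0) ^ (i - m) * (Nat.choose i m : MvPolynomial (Fin 2) k)) : MvPolynomial (Fin 2) k)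
      = C ((Nat.choose i m : k) * t ^ (i - m)) * X 0 ^ (d - i + (i - m)) * X 1 ^ m := by
      rw [mul_pow, C_mul, C_pow, pow_add, map_natCast]; ring
    rw [this, mon_eq, coeff_monomial]
    simp only [exp_inj]
    by_cases h : m = j
    · rw [if_pos ⟨by omega, h⟩, if_pos h, h]
    · rw [if_neg (fun h' => h h'.2), if_neg h]
  rw [Finset.sum_congr rfl e, Finset.sum_ite_eq']
  split_ifs with h
  · rfl
  · rw [Nat.choose_eq_zero_of_lt (by simpa [Nat.lt_succ_iff] using h)]; simp

lemma matAct_toForm (g : Matrix (Fin 2) (Fin 2) k) (a : Fin (d+1) → k) :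
    matAct k g (toForm k d a) = ∑ i : Fin (d+1), C (a i) *
      ((C (g 0 0) * X 0 + C (g 0 1) * X 1) ^ (d - (i:ℕ)) * (C (g 1 0) * X 0 + C (g 1 1) * X 1) ^ (i:ℕ)) := by
  simp only [matAct, toForm, map_sum, map_mul, map_pow, aeval_X, mul_assoc]
  apply Finset.sum_congr rfl
  intro i _
  rw [aeval_C, MvPolynomial.algebraMap_eq]

def bU (a : Fin (d+1) → k) (j : Fin (d+1)) : Polynomial k :=
  ∑ i : Fin (d+1), Polynomial.C (a i * Nat.choose (d - i) (d - j)) * Polynomial.X ^ ((j:ℕ) - (i:ℕ))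

def bL (a : Fin (d+1) → k) (j : Fin (d+1)) : Polynomial k :=
  ∑ i : Fin (d+1), Polynomial.C (a i * Nat.choose i j) * Polynomial.X ^ ((i:ℕ) - (j:ℕ))

lemma actCoeff_upper (t : k) (a : Fin (d+1) → k) :
    actCoeff k d !![1, t; 0, 1] a = fun j => (bU a j).eval t := by
  funext j
  rw [actCoeff, formCoeff, matAct_toForm, coeff_sum, bU, Polynomial.eval_finsetSum]
  apply Finset.sum_congr rfl
  intro i _
  have := coeff_upper (d := d) t i j (by omega) (by omega)
  simp [coeff_C_mul, -Finsupp.single_tsub, this, mul_assoc]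

lemma actCoeff_lower (t : k) (a : Fin (d+1) → k) :
    actCoeff k d !![1, 0; t, 1] a = fun j => (bL a j).eval t := by
  funext j
  rw [actCoeff, formCoeff, matAct_toForm, coeff_sum, bL, Polynomial.eval_finsetSum]
  apply Finset.sum_congr rfl
  intro i _
  have := coeff_lower (d := d) t i j (by omega) (by omega)
  rw [add_comm (X 1) _] at this
  simp [coeff_C_mul, -Finsupp.single_tsub, this, mul_assoc]

lemma toForm_formCoeff (p : MvPolynomial (Fin 2) k) (hp : p.IsHomogeneous d) :
    toForm k d (formCoeff k d p) = p := by
  classical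
  ext m
  have hm : m = Finsupp.single 0 (m 0) + Finsupp.single 1 (m 1) := by
    ext i; fin_cases i <;> simp
  rw [toForm, coeff_sum]
  simp only [mon_eq, coeff_monomial]
  by_cases h : m 0 + m 1 = d
  · rw [Finset.sum_eq_single (⟨m 1, by omega⟩ : Fin (d+1))]
    · have : d - m 1 = m 0 := by omega
      simp only [formCoeff, this, ← hm, if_true]
    · intro b _ hb
      rw [if_neg]
      intro h'
      rw [hm, exp_inj] at h'
      exact hb (Fin.ext h'.2)
    · simp
  · rw [Finset.sum_eq_zero, hp.coeff_eq_zero]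
    · rw [hm]; simp [Finsupp.degree_eq_sum, h]
    · intro i _
      rw [if_neg]
      intro h'
      rw [hm, exp_inj] at h'
      omega

lemma formCoeff_toForm (a : Fin (d+1) → k) : formCoeff k d (toForm k d a) = a := by
  classical
  funext j
  simp only [formCoeff, toForm, coeff_sum, mon_eq, coeff_monomial, exp_inj]
  rw [Finset.sum_eq_single j]
  · simp
  · intro b _ hb
    rw [if_neg]
    exact fun h => hb (Fin.ext h.2)
  · simp

lemma matAct_hom (g : Matrix (Fin 2) (Fin 2) k) (a : Fin (d+1) → k) :
    (matAct k g (toForm k d a)).IsHomogeneous d := by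
  rw [matAct_toForm]
  apply IsHomogeneous.sum
  intro i _
  have hl : ∀ r s : k, (C r * X 0 + C s * X 1 : MvPolynomial (Fin 2) k).IsHomogeneous 1 := fun r s =>
    ((isHomogeneous_X k 0).C_mul r).add ((isHomogeneous_X k 1).C_mul s)
  have := ((hl (g 0 0) (g 0 1)).pow (d - i)).mul ((hl (g 1 0) (g 1 1)).pow i)
  have e : 1 * (d - (i:ℕ)) + 1 * (i:ℕ) = d := by omega
  rw [e] at this
  exact this.C_mul _

lemma matAct_mul (g h : Matrix (Fin 2) (Fin 2) k) (p : MvPolynomial (Fin 2) k) :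
    matAct k g (matAct k h p) = matAct k (h * g) p := by
  unfold matAct
  have : (aeval (fun j : Fin 2 => C (g j 0) * X 0 + C (g j 1) * X 1) :
        MvPolynomial (Fin 2) k →ₐ[k] MvPolynomial (Fin 2) k).comp
      (aeval (fun j : Fin 2 => C (h j 0) * X 0 + C (h j 1) * X 1)) =
      aeval (fun j : Fin 2 => C ((h * g) j 0) * X 0 + C ((h * g) j 1) * X 1) := by
    apply algHom_ext
    intro j
    simp only [AlgHom.comp_apply, aeval_X, map_add, map_mul, algHom_C, MvPolynomial.algebraMap_eq,
      Matrix.mul_apply, Fin.sum_univ_two]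
    ring
  exact DFunLike.congr_fun this p

lemma actCoeff_mul (g h : Matrix (Fin 2) (Fin 2) k) (a : Fin (d+1) → k) :
    actCoeff k d g (actCoeff k d h a) = actCoeff k d (h * g) a := by
  unfold actCoeff
  rw [toForm_formCoeff _ (matAct_hom h a), matAct_mul]

lemma actCoeff_one (a : Fin (d+1) → k) : actCoeff k d 1 a = a := by
  unfold actCoeff
  have : matAct k 1 (toForm k d a) = toForm k d a := by
    rw [matAct_toForm, toForm]; simp [mul_assoc]
  rw [this, formCoeff_toForm]

lemma chain (b : Fin (d+1) → Polynomial k)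
    (D : Derivation k (MvPolynomial (Fin (d+1)) k) (MvPolynomial (Fin (d+1)) k))
    (hb : ∀ i, Polynomial.derivative (b i) = aeval b (D (X i))) (f) :
    Polynomial.derivative (aeval b f) = aeval b (D f) := by
  induction f using MvPolynomial.induction_on with
  | C r => simp [MvPolynomial.derivation_C, Polynomial.algebraMap_eq]
  | add p q hp hq => simp [hp, hq]
  | mul_X p i hp =>
    simp only [map_mul, aeval_X, Polynomial.derivative_mul, hp, hb, Derivation.leibniz, map_add, smul_eq_mul]
    ring

lemma eval_aeval (b : Fin (d+1) → Polynomial k) (f : MvPolynomial (Fin (d+1)) k) (t : k) :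
    (aeval b f).eval t = eval (fun i => (b i).eval t) f := by
  induction f using MvPolynomial.induction_on with
  | C r => simp [Polynomial.algebraMap_eq]
  | add p q hp hq => simp [hp, hq]
  | mul_X p i hp => simp [hp]

lemma const_of (b : Fin (d+1) → Polynomial k) [CharZero k]
    (D : Derivation k (MvPolynomial (Fin (d+1)) k) (MvPolynomial (Fin (d+1)) k))
    (hb : ∀ i, Polynomial.derivative (b i) = aeval b (D (X i))) (f) (hf : D f = 0) (t : k) :
    eval (fun i => (b i).eval t) f = eval (fun i => (b i).eval 0) f := by
  have h := chain b D hb f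
  rw [hf, map_zero] at h
  have := Polynomial.eq_C_of_natDegree_eq_zero (Polynomial.derivative_eq_zero.1 h)
  rw [← eval_aeval, ← eval_aeval, this]
  simp

lemma of_const (b : Fin (d+1) → Polynomial k) [CharZero k]
    (D : Derivation k (MvPolynomial (Fin (d+1)) k) (MvPolynomial (Fin (d+1)) k))
    (hb : ∀ i, Polynomial.derivative (b i) = aeval b (D (X i))) (f)
    (hf : ∀ t, eval (fun i => (b i).eval t) f = eval (fun i => (b i).eval 0) f) :
    eval (fun i => (b i).eval 0) (D f) = 0 := by
  have h := chain b D hb f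
  have : aeval b f = Polynomial.C (eval (fun i => (b i).eval 0) f) := by
    apply Polynomial.funext
    intro t
    rw [eval_aeval, hf]; simp
  rw [this, Polynomial.derivative_C] at h
  rw [← eval_aeval, ← h]; simp

lemma choose_aux (n l : ℕ) : (Nat.choose n l : k) * ((n - l : ℕ) : k) = (Nat.choose n (l+1) : k) * ((l:k) + 1) := by
  have := congrArg (Nat.cast : ℕ → k) (Nat.choose_succ_right_eq n l)
  rw [Nat.cast_mul, Nat.cast_mul, Nat.cast_add, Nat.cast_one] at this
  exact this.symm

lemma deriv_bU (a : Fin (d+1) → k) (j : Fin (d+1)) :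
    Polynomial.derivative (bU a j) = aeval (bU a) (dE k d (X j)) := by
  obtain ⟨j, hj⟩ := j
  rw [dE, mkDerivation_X]
  simp only
  rw [bU, Polynomial.derivative_sum]
  split_ifs with h
  · rw [map_mul, aeval_X, bU, aeval_C, Finset.mul_sum, Polynomial.algebraMap_eq]
    apply Finset.sum_congr rfl
    rintro ⟨i, hi⟩ _
    simp only
    rw [Polynomial.derivative_C_mul_X_pow, ← mul_assoc, ← Polynomial.C_mul]
    have := choose_aux (k := k) (d - i) (d - j)
    rw [show d - i - (d - j) = j - i by omega] at this
    rw [show d - (j - 1) = d - j + 1 by omega, show j - 1 - i = j - i - 1 by omega]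
    congr 2
    rw [Nat.cast_sub (show j ≤ d by omega)] at this
    linear_combination (a ⟨i, hi⟩) * this
  · rw [map_zero]
    apply Finset.sum_eq_zero
    rintro ⟨i, hi⟩ _
    rw [show j - i = 0 by omega]; simp

lemma deriv_bL (a : Fin (d+1) → k) (j : Fin (d+1)) :
    Polynomial.derivative (bL a j) = aeval (bL a) (dF k d (X j)) := by
  obtain ⟨j, hj⟩ := j
  rw [dF, mkDerivation_X]
  simp only
  rw [bL, Polynomial.derivative_sum]
  split_ifs with h
  · rw [map_mul, aeval_X, bL, aeval_C, Finset.mul_sum, Polynomial.algebraMap_eq]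
    apply Finset.sum_congr rfl
    rintro ⟨i, hi⟩ _
    simp only
    rw [Polynomial.derivative_C_mul_X_pow, ← mul_assoc, ← Polynomial.C_mul]
    have := choose_aux (k := k) i j
    rw [show i - (j + 1) = i - j - 1 by omega]
    congr 2
    linear_combination (a ⟨i, hi⟩) * this
  · rw [map_zero]
    apply Finset.sum_eq_zero
    rintro ⟨i, hi⟩ _
    simp only
    rw [show i - j = 0 by omega]; simp

lemma bU_zero (a : Fin (d+1) → k) : (fun i => (bU a i).eval 0) = a := by
  rw [← actCoeff_upper, ← Matrix.one_fin_two, actCoeff_one]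
lemma bL_zero (a : Fin (d+1) → k) : (fun i => (bL a i).eval 0) = a := by
  rw [← actCoeff_lower, ← Matrix.one_fin_two, actCoeff_one]

lemma E_of_inv [CharZero k] (f : MvPolynomial (Fin (d+1)) k) (hf : SL2Invariant k d f) : dE k d f = 0 := by
  apply MvPolynomial.funext
  intro a
  have := of_const (bU a) (dE k d) (deriv_bU a) f (fun t => by
    rw [bU_zero, ← actCoeff_upper]
    exact hf ⟨!![1, t; 0, 1], by simp [Matrix.det_fin_two]⟩ a)
  rw [bU_zero] at this
  simpa using this

lemma F_of_inv [CharZero k] (f : MvPolynomial (Fin (d+1)) k) (hf : SL2Invariant k d f) : dF k d f = 0 := by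
  apply MvPolynomial.funext
  intro a
  have := of_const (bL a) (dF k d) (deriv_bL a) f (fun t => by
    rw [bL_zero, ← actCoeff_lower]
    exact hf ⟨!![1, 0; t, 1], by simp [Matrix.det_fin_two]⟩ a)
  rw [bL_zero] at this
  simpa using this

lemma inv_of_EF [CharZero k] (f : MvPolynomial (Fin (d+1)) k) (hE : dE k d f = 0) (hF : dF k d f = 0) :
    SL2Invariant k d f := by
  have hU : ∀ t a, eval (actCoeff k d !![1, t; 0, 1] a) f = eval a f := by
    intro t a
    rw [actCoeff_upper, const_of (bU a) (dE k d) (deriv_bU a) f hE, bU_zero]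
  have hL : ∀ t a, eval (actCoeff k d !![1, 0; t, 1] a) f = eval a f := by
    intro t a
    rw [actCoeff_lower, const_of (bL a) (dF k d) (deriv_bL a) f hF, bL_zero]
  have hc : ∀ p q r s : k, p * s - q * r = 1 → r ≠ 0 → ∀ a, eval (actCoeff k d !![p, q; r, s] a) f = eval a f := by
    intro p q r s hdet hr a
    have e : !![p, q; r, s] = !![1, (p-1)/r; 0, 1] * !![1, 0; r, 1] * !![1, (s-1)/r; 0, 1] := by
      simp only [Matrix.mul_fin_two]
      congr 1
      have h2 : 1 + (p-1)/r * r = p := by field_simp; ring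
      have h3 : r * ((s-1)/r) + 1 = s := by field_simp; ring
      have h1 : p * ((s-1)/r) + (p-1)/r = q := by
        field_simp; linear_combination hdet
      simp only [mul_one, one_mul, mul_zero, add_zero, zero_add]
      rw [h2, h3, h1]
    rw [e, ← actCoeff_mul, hU, ← actCoeff_mul, hL, hU]
  rintro ⟨g, hg⟩ a
  rw [Matrix.det_fin_two] at hg
  simp only
  by_cases hr : g 1 0 = 0
  · have hp : g 1 1 ≠ 0 := by rintro h; simp [h, hr] at hg
    rw [← hL 1 (actCoeff k d g a), actCoeff_mul, Matrix.eta_fin_two g, Matrix.mul_fin_two]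
    apply hc
    · linear_combination hg
    · simpa [hr] using hp
  · rw [Matrix.eta_fin_two g]
    exact hc _ _ _ _ hg hr a
end group

section reynolds
variable {k : Type*} [Field k] {d : ℕ}

/-- The truncated Reynolds operator. -/
def reyn (N : ℕ) : MvPolynomial (Fin (d+1)) k →ₗ[k] MvPolynomial (Fin (d+1)) k where
  toFun f := sl2P (dE k d).toLinearMap (dF k d).toLinearMap N (pi0 d f)
  map_add' x y := by
    simp only [sl2P, map_add, iterate_map_add, smul_add, Finset.sum_add_distrib]
  map_smul' c x := by
    simp only [sl2P, map_smul, Finset.smul_sum, RingHom.id_apply]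
    apply Finset.sum_congr rfl
    intro n _
    have h : ∀ (L : MvPolynomial (Fin (d+1)) k →ₗ[k] MvPolynomial (Fin (d+1)) k) (v), L^[n] (c • v) = c • L^[n] v := by
      intro L v
      rw [← Module.End.pow_apply, map_smul, Module.End.pow_apply]
    rw [h, h, smul_comm]

lemma reyn_apply (N : ℕ) (f : MvPolynomial (Fin (d+1)) k) :
    reyn N f = ∑ n ∈ Finset.range N, sl2c k n • (dF k d)^[n] ((dE k d)^[n] (pi0 d f)) := rfl

lemma pi0_one : pi0 d (1 : MvPolynomial (Fin (d+1)) k) = 1 :=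
  (isWeightedHomogeneous_one k (wt d)).weightedHomogeneousComponent_same

lemma reyn_one (N : ℕ) : reyn (N+1) (1 : MvPolynomial (Fin (d+1)) k) = 1 := by
  rw [reyn_apply, pi0_one, Finset.sum_range_succ', Finset.sum_eq_zero]
  · simp [sl2c]
  · intro n _
    rw [Function.iterate_succ_apply (dE k d), Derivation.map_one_eq_zero, iterate_map_zero,
      iterate_map_zero, smul_zero]

lemma iter_mul (D : Derivation k (MvPolynomial (Fin (d+1)) k) (MvPolynomial (Fin (d+1)) k))
    (x : MvPolynomial (Fin (d+1)) k) (hx : D x = 0) (n : ℕ) (f) : D^[n] (f * x) = D^[n] f * x := by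
  induction n with
  | zero => rfl
  | succ n ih =>
    rw [Function.iterate_succ_apply', ih, Derivation.leibniz, hx, Function.iterate_succ_apply']
    simp [mul_comm]

variable [CharZero k]

lemma reyn_mul (N : ℕ) (f x : MvPolynomial (Fin (d+1)) k) (hx : SL2Invariant k d x) :
    reyn N (f * x) = reyn N f * x := by
  have hE := E_of_inv x hx
  have hF := F_of_inv x hx
  have hH : dH k d x = 0 := by
    have := hEF x
    rw [hE, hF, map_zero, map_zero, zero_add] at this
    exact this.symm
  rw [reyn_apply, reyn_apply, pi0_mul x f ((dH_zero_iff x).1 hH), Finset.sum_mul]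
  apply Finset.sum_congr rfl
  intro n _
  rw [iter_mul _ x hE, iter_mul _ x hF, smul_mul_assoc]

lemma reyn_inv (f : MvPolynomial (Fin (d+1)) k) : ∃ N0, ∀ N ≥ N0, SL2Invariant k d (reyn N f) := by
  obtain ⟨n, hn⟩ := nil_E (pi0 d f)
  refine ⟨n + 1, fun N hN => ?_⟩
  obtain ⟨N, rfl⟩ : ∃ N', N = N' + 1 := ⟨N - 1, by omega⟩
  have hH0 : dH k d (pi0 d f) = 0 :=
    (dH_zero_iff _).2 (weightedHomogeneousComponent_isWeightedHomogeneous 0 f)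
  have hE : dE k d (reyn (N+1) f) = 0 := by
    have := sl2_E_P (dE k d).toLinearMap (dF k d).toLinearMap (dH k d).toLinearMap
      hEF hHF hHE (pi0 d f) hH0 N
    refine Eq.trans this ?_
    have h2 : (dE k d)^[N+1] (pi0 d f) = 0 := nil_mono _ (by omega) hn
    have h3 : ((dE k d).toLinearMap)^[N+1] (pi0 d f) = 0 := h2
    rw [h3, iterate_map_zero, smul_zero]
  have hH : dH k d (reyn (N+1) f) = 0 :=
    sl2_H_P (dE k d).toLinearMap (dF k d).toLinearMap (dH k d).toLinearMap
      hHF hHE (pi0 d f) hH0 (N+1)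
  have hF : dF k d (reyn (N+1) f) = 0 :=
    sl2_F_zero (dE k d).toLinearMap (dF k d).toLinearMap (dH k d).toLinearMap
      hEF hHF _ hH hE (nil_F _)
  exact inv_of_EF _ hE hF
end reynolds

/-- Every maximal ideal of `R_d` is contained in a maximal ideal of `k[A_0,…,A_d]`. -/
theorem every_maximal_ideal_of_invariant_ring_extends
    (k : Type*) [Field k] [CharZero k] (d : ℕ)
    (M : Ideal (Rd k d)) (hM : M.IsMaximal) :
    ∃ N : Ideal (MvPolynomial (Fin (d+1)) k), N.IsMaximal ∧
      ∀ x : Rd k d, x ∈ M → (x : MvPolynomial (Fin (d+1)) k) ∈ N := by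
  classical
  by_contra hcon
  push Not at hcon
  have hone : (1 : MvPolynomial (Fin (d+1)) k) ∈
      Ideal.span ((fun x : Rd k d => (x : MvPolynomial (Fin (d+1)) k)) '' (M : Set (Rd k d))) := by
    by_contra h
    obtain ⟨N, hN, hle⟩ := Ideal.exists_le_maximal _ ((Ideal.ne_top_iff_one _).2 h)
    obtain ⟨x, hx, hxN⟩ := hcon N hN
    exact hxN (hle (Ideal.subset_span ⟨x, hx, rfl⟩))
  have key : ∀ y ∈ Ideal.span ((fun x : Rd k d => (x : MvPolynomial (Fin (d+1)) k)) '' (M : Set (Rd k d))),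
      ∀ f : MvPolynomial (Fin (d+1)) k, ∃ N0, ∀ N ≥ N0, ∃ z : Rd k d, z ∈ M ∧
        (z : MvPolynomial (Fin (d+1)) k) = reyn N (f * y) := by
    intro y hy
    induction hy using Submodule.span_induction with
    | mem y hy =>
      obtain ⟨x, hx, rfl⟩ := hy
      intro f
      obtain ⟨N0, h0⟩ := reyn_inv f
      refine ⟨N0, fun N hN => ⟨⟨reyn N f, h0 N hN⟩ * x, M.mul_mem_left _ hx, ?_⟩⟩
      exact (reyn_mul N f x x.2).symm
    | zero =>
      intro f
      exact ⟨0, fun N _ => ⟨0, M.zero_mem, by rw [mul_zero, map_zero]; rfl⟩⟩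
    | add y z _ _ hy hz =>
      intro f
      obtain ⟨N1, h1⟩ := hy f
      obtain ⟨N2, h2⟩ := hz f
      refine ⟨max N1 N2, fun N hN => ?_⟩
      obtain ⟨u, hu, hu'⟩ := h1 N (le_trans (le_max_left _ _) hN)
      obtain ⟨v, hv, hv'⟩ := h2 N (le_trans (le_max_right _ _) hN)
      exact ⟨u + v, M.add_mem hu hv, by rw [mul_add, map_add, ← hu', ← hv']; rfl⟩
    | smul c y _ hy =>
      intro f
      obtain ⟨N0, h0⟩ := hy (f * c)
      exact ⟨N0, fun N hN => by simpa only [smul_eq_mul, mul_assoc] using h0 N hN⟩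
  obtain ⟨N0, h0⟩ := key 1 hone 1
  obtain ⟨z, hz, hz'⟩ := h0 (N0 + 1) (by omega)
  rw [mul_one, reyn_one] at hz'
  have : z = 1 := Subtype.ext hz'
  rw [this] at hz
  exact hM.ne_top ((Ideal.eq_top_iff_one _).2 hz)
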